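/- Let n = 2^m, 0 ≤ i ≤ n−1, u_{2i−1} ∈ F_2^{2i} and u_{2i} ∈ F_2. Then the polar coset of length 2n satisfies C_{2n}^{(2i)}(u_{2i−1}, u_{2i}) = ⋃_{u_{2i+1} ∈ F_2} { (c_1, c_2) : c_1 ∈ C_n^{(i)}(u_{2i−1,even} ⊕ u_{2i−1,odd}, u_{2i} ⊕ u_{2i+1}), c_2 ∈ C_n^{(i)}(u_{2i−1,odd}, u_{2i+1}) }, where (c_1, c_2) denotes concatenation; moreover the two sets in the union (for u_{2i+1} = 0 and u_{2i+1} = 1) are disjoint. -/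

import Mathlib

open Matrix

/-- The 2×2 polar kernel over F₂. -/
def K2 : Matrix (Fin 2) (Fin 2) (ZMod 2) := !![1, 0; 1, 1]

/-- The `m`-fold Kronecker power of `K2`, rows and columns indexed by
binary expansions (bit `k` of the index corresponds to the `k`-th factor). -/
def kronPow (m : ℕ) : Matrix (Fin (2 ^ m)) (Fin (2 ^ m)) (ZMod 2) :=
  Matrix.of fun i j => ∏ k ∈ Finset.range m,
    K2 ⟨i.val / 2 ^ k % 2, Nat.mod_lt _ (by norm_num)⟩
       ⟨j.val / 2 ^ k % 2, Nat.mod_lt _ (by norm_num)⟩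

/-- Reversal of the `m`-bit binary expansion of `i`. -/
def bitrev (m i : ℕ) : ℕ := ∑ k ∈ Finset.range m, (i / 2 ^ k % 2) * 2 ^ (m - 1 - k)

/-- The `2^m × 2^m` bit-reversal permutation matrix. -/
def Bmat (m : ℕ) : Matrix (Fin (2 ^ m)) (Fin (2 ^ m)) (ZMod 2) :=
  Matrix.of fun i j => if (j : ℕ) = bitrev m i.val then 1 else 0

/-- The polar transformation matrix `G_n = B_n K_2^{⊗ m}`, `n = 2^m`. -/
def Gmat (m : ℕ) : Matrix (Fin (2 ^ m)) (Fin (2 ^ m)) (ZMod 2) := Bmat m * kronPow m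

/-- Assembling the vector `(u_{i-1}, u_i, u')` out of a prefix `p` of length `i`,
a bit `b`, and a suffix `s` of length `n - 1 - i`. -/
def assemble {n : ℕ} (i : ℕ) (p : Fin i → ZMod 2) (b : ZMod 2)
    (s : Fin (n - 1 - i) → ZMod 2) : Fin n → ZMod 2 :=
  fun j =>
    if h : (j : ℕ) < i then p ⟨j, h⟩
    else if h2 : (j : ℕ) = i then b
    else s ⟨(j : ℕ) - i - 1, by have h3 := j.isLt; omega⟩

/-- The polar coset `C_n^{(i)}(u_{i-1}, u_i)`, `n = 2^m`. -/
def polarCoset (m i : ℕ) (p : Fin i → ZMod 2) (b : ZMod 2) :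
    Set (Fin (2 ^ m) → ZMod 2) :=
  { c | ∃ s : Fin (2 ^ m - 1 - i) → ZMod 2, c = (assemble i p b s) ᵥ* Gmat m }

/-- Even-index subvector. -/
def evPart {i : ℕ} (p : Fin (2 * i) → ZMod 2) : Fin i → ZMod 2 :=
  fun k => p ⟨2 * k.val, by have := k.isLt; omega⟩

/-- Odd-index subvector. -/
def odPart {i : ℕ} (p : Fin (2 * i) → ZMod 2) : Fin i → ZMod 2 :=
  fun k => p ⟨2 * k.val + 1, by have := k.isLt; omega⟩

/-- Concatenation of two length-`2^m` vectors into a length-`2^(m+1)` vector. -/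
def concatPow {m : ℕ} (a b : Fin (2 ^ m) → ZMod 2) : Fin (2 ^ (m + 1)) → ZMod 2 :=
  fun j =>
    if h : (j : ℕ) < 2 ^ m then a ⟨j, h⟩
    else b ⟨(j : ℕ) - 2 ^ m, by
      have h1 := j.isLt
      have h2 : (2 : ℕ) ^ (m + 1) = 2 ^ m * 2 := pow_succ 2 m
      have h3 : 1 ≤ (2 : ℕ) ^ m := Nat.one_le_two_pow
      omega⟩

/-- The weight enumerating function `A_n^{(i)}(u_{i-1}, u_i)(X)` of a polar coset. -/
noncomputable def cosetWEF (m i : ℕ) (p : Fin i → ZMod 2) (b : ZMod 2) : Polynomial ℕ :=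
  ∑ c ∈ (polarCoset m i p b).toFinite.toFinset, Polynomial.X ^ hammingNorm c

/-- The entries of `kronPow m`, as a function of arbitrary natural-number indices. -/
def kronEntry (m x y : ℕ) : ZMod 2 :=
  ∏ k ∈ Finset.range m,
    K2 ⟨x / 2 ^ k % 2, Nat.mod_lt _ (by norm_num)⟩ ⟨y / 2 ^ k % 2, Nat.mod_lt _ (by norm_num)⟩

theorem mul_two_pow_add_div_mod_two {m k : ℕ} (hk : k < m) (a x : ℕ) :
    (a * 2 ^ m + x) / 2 ^ k % 2 = x / 2 ^ k % 2 := by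
  obtain ⟨d, rfl⟩ := Nat.exists_eq_add_of_lt hk
  have h : a * 2 ^ (k + d + 1) + x = x + 2 ^ k * (2 * (a * 2 ^ d)) := by ring
  rw [h, Nat.add_mul_div_left _ _ (by positivity), Nat.add_mul_mod_self_left]

theorem mul_two_pow_add_div_two_pow {m x : ℕ} (hx : x < 2 ^ m) (a : ℕ) :
    (a * 2 ^ m + x) / 2 ^ m = a := by
  rw [mul_comm, Nat.mul_add_div (by positivity), Nat.div_eq_of_lt hx, add_zero]

theorem kronEntry_succ {m x y : ℕ} (hx : x < 2 ^ m) (hy : y < 2 ^ m) (a b : Fin 2) :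
    kronEntry (m + 1) (a * 2 ^ m + x) (b * 2 ^ m + y) = kronEntry m x y * K2 a b := by
  rw [kronEntry, Finset.prod_range_succ]
  congr 1
  · refine Finset.prod_congr rfl fun k hk => ?_
    have hk := Finset.mem_range.mp hk
    simp only [mul_two_pow_add_div_mod_two hk]
  · simp only [mul_two_pow_add_div_two_pow hx, mul_two_pow_add_div_two_pow hy,
      Nat.mod_eq_of_lt a.isLt, Nat.mod_eq_of_lt b.isLt, Fin.eta]

theorem bitrev_succ (m x : ℕ) : bitrev (m + 1) x = x % 2 * 2 ^ m + bitrev m (x / 2) := by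
  rw [bitrev, Finset.sum_range_succ', add_comm]
  congr 1
  · simp
  · refine Finset.sum_congr rfl fun k _ => ?_
    rw [pow_succ', Nat.div_div_eq_div_mul, Nat.sub_sub, Nat.sub_sub, Nat.add_comm k 1,
      ← Nat.add_assoc, Nat.add_comm m 1, Nat.add_assoc, Nat.add_sub_add_left]

theorem bitrev_lt (m x : ℕ) : bitrev m x < 2 ^ m := by
  induction m generalizing x with
  | zero => simp [bitrev]
  | succ m ih =>
    rw [bitrev_succ, pow_succ]
    have h := ih (x / 2)
    rcases Nat.mod_two_eq_zero_or_one x with hx | hx <;> rw [hx] <;> omega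

theorem Gmat_apply (m : ℕ) (x y : Fin (2 ^ m)) :
    Gmat m x y = kronEntry m (bitrev m x) y := by
  rw [Gmat, Matrix.mul_apply, Finset.sum_eq_single ⟨bitrev m x, bitrev_lt m x⟩]
  · simp [Bmat, kronPow, kronEntry]
  · intro z _ hz
    have hz : (z : ℕ) ≠ bitrev m x := fun h => hz (Fin.ext h)
    simp [Bmat, hz]
  · simp

/-- The index `2 * x + a` of a length-`2 ^ (m + 1)` vector. -/
def interleaveEquiv (m : ℕ) : Fin (2 ^ m) × Fin 2 ≃ Fin (2 ^ (m + 1)) :=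
  finProdFinEquiv.trans (finCongr (pow_succ 2 m).symm)

@[simp]
theorem interleaveEquiv_val (m : ℕ) (x : Fin (2 ^ m)) (a : Fin 2) :
    (interleaveEquiv m (x, a) : ℕ) = a + 2 * x := by
  simp [interleaveEquiv]

theorem Gmat_succ_apply {m : ℕ} (x y : Fin (2 ^ m)) (a b : Fin 2) (z : Fin (2 ^ (m + 1)))
    (hz : (z : ℕ) = b * 2 ^ m + y) :
    Gmat (m + 1) (interleaveEquiv m (x, a)) z = Gmat m x y * K2 a b := by
  have hmod : ((a : ℕ) + 2 * x) % 2 = a := by omega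
  have hdiv : ((a : ℕ) + 2 * x) / 2 = x := by omega
  rw [Gmat_apply, Gmat_apply, bitrev_succ, hz, interleaveEquiv_val, hmod, hdiv,
    kronEntry_succ (bitrev_lt m x) y.isLt]

/-- The even-index half (`a = 0`) or odd-index half (`a = 1`) of a vector. -/
def halfVec {m : ℕ} (a : Fin 2) (u : Fin (2 ^ (m + 1)) → ZMod 2) : Fin (2 ^ m) → ZMod 2 :=
  fun x => u (interleaveEquiv m (x, a))

theorem vecMul_Gmat_succ {m : ℕ} (u : Fin (2 ^ (m + 1)) → ZMod 2) :
    u ᵥ* Gmat (m + 1) =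
      concatPow ((halfVec 0 u + halfVec 1 u) ᵥ* Gmat m) (halfVec 1 u ᵥ* Gmat m) := by
  have key (y : Fin (2 ^ m)) (b : Fin 2) (z : Fin (2 ^ (m + 1)))
      (hz : (z : ℕ) = b * 2 ^ m + y) :
      (u ᵥ* Gmat (m + 1)) z =
        ∑ x, (halfVec 0 u x * (Gmat m x y * K2 0 b) + halfVec 1 u x * (Gmat m x y * K2 1 b)) := by
    simp only [Matrix.vecMul, dotProduct]
    rw [← (interleaveEquiv m).sum_comp, Fintype.sum_prod_type]
    refine Finset.sum_congr rfl fun x _ => ?_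
    simp [Fin.sum_univ_two, Gmat_succ_apply x y _ b z hz, halfVec]
  funext z
  by_cases h : (z : ℕ) < 2 ^ m
  · rw [key ⟨z, h⟩ 0 z (by simp), concatPow, dif_pos h]
    simp [Matrix.vecMul, dotProduct, K2, add_mul]
  · have hlt : (z : ℕ) - 2 ^ m < 2 ^ m := by
      have := z.isLt.trans_eq (pow_succ 2 m)
      omega
    rw [key ⟨z - 2 ^ m, hlt⟩ 1 z (by simp; omega), concatPow, dif_neg h]
    simp [Matrix.vecMul, dotProduct, K2]

theorem concatPow_inj {m : ℕ} {a b a' b' : Fin (2 ^ m) → ZMod 2} :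
    concatPow a b = concatPow a' b' ↔ a = a' ∧ b = b' := by
  refine ⟨fun h => ⟨funext fun x => ?_, funext fun x => ?_⟩, by rintro ⟨rfl, rfl⟩; rfl⟩
  · have hx := x.isLt
    simpa [concatPow] using congrFun h ⟨x, by rw [pow_succ]; omega⟩
  · have hx := x.isLt
    simpa [concatPow] using congrFun h ⟨2 ^ m + x, by rw [pow_succ]; omega⟩

theorem eq_of_halfVec_eq {m : ℕ} {u v : Fin (2 ^ (m + 1)) → ZMod 2}
    (h0 : halfVec 0 u = halfVec 0 v) (h1 : halfVec 1 u = halfVec 1 v) : u = v := by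
  funext z
  obtain ⟨⟨x, a⟩, rfl⟩ := (interleaveEquiv m).surjective z
  fin_cases a
  · exact congrFun h0 x
  · exact congrFun h1 x

theorem vecMul_Gmat_injective (m : ℕ) :
    Function.Injective fun u : Fin (2 ^ m) → ZMod 2 => u ᵥ* Gmat m := by
  induction m with
  | zero =>
    have h : Gmat 0 = 1 := by
      ext x y
      have hxy : x = y := (inferInstance : Subsingleton (Fin 1)).elim x y
      rw [Gmat_apply, hxy]
      simp [kronEntry]
    intro u v huv
    simpa [h] using huv
  | succ m ih =>
    intro u v huv
    simp only [vecMul_Gmat_succ] at huv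
    obtain ⟨h, h'⟩ := concatPow_inj.mp huv
    have h1 := ih h'
    have h0 := ih h
    rw [h1] at h0
    exact eq_of_halfVec_eq (add_right_cancel h0) h1

theorem mem_polarCoset_iff {m i : ℕ} (hi : i < 2 ^ m) {p : Fin i → ZMod 2} {b : ZMod 2}
    {c : Fin (2 ^ m) → ZMod 2} :
    c ∈ polarCoset m i p b ↔ ∃ u : Fin (2 ^ m) → ZMod 2,
      (∀ k : Fin i, u ⟨k, k.isLt.trans hi⟩ = p k) ∧ u ⟨i, hi⟩ = b ∧ c = u ᵥ* Gmat m := by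
  constructor
  · rintro ⟨s, rfl⟩
    exact ⟨assemble i p b s, fun k => by simp [assemble], by simp [assemble], rfl⟩
  · rintro ⟨u, hp, hb, rfl⟩
    refine ⟨fun k => u ⟨k + i + 1, by omega⟩, ?_⟩
    congr 1
    funext j
    unfold assemble
    split_ifs with h h'
    · exact hp ⟨j, h⟩
    · rw [← hb]
      exact congrArg u (Fin.ext h')
    · exact congrArg u (Fin.ext (by simp only; omega))

theorem forall_init_eq_iff {m i : ℕ} (hi : 2 * i < 2 ^ (m + 1)) (hi' : i < 2 ^ m)
    (p : Fin (2 * i) → ZMod 2) (u : Fin (2 ^ (m + 1)) → ZMod 2) :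
    (∀ k : Fin (2 * i), u ⟨k, k.isLt.trans hi⟩ = p k) ↔
      (∀ k : Fin i, halfVec 0 u ⟨k, k.isLt.trans hi'⟩ = evPart p k) ∧
        ∀ k : Fin i, halfVec 1 u ⟨k, k.isLt.trans hi'⟩ = odPart p k := by
  have even_eq (x : Fin (2 ^ m)) (h) : u ⟨2 * x, h⟩ = halfVec 0 u x :=
    congrArg u (Fin.ext (by simp))
  have odd_eq (x : Fin (2 ^ m)) (h) : u ⟨2 * x + 1, h⟩ = halfVec 1 u x :=
    congrArg u (Fin.ext (by simp; omega))
  constructor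
  · intro h
    refine ⟨fun k => ?_, fun k => ?_⟩
    · rw [← even_eq _ (by simp only; omega)]
      exact h ⟨2 * k, by omega⟩
    · rw [← odd_eq _ (by simp only; omega)]
      exact h ⟨2 * k + 1, by omega⟩
  · rintro ⟨h0, h1⟩ ⟨k, hk⟩
    obtain ⟨l, rfl | rfl⟩ := Nat.even_or_odd' k
    · exact (even_eq ⟨l, by omega⟩ (by simp only; omega)).trans (h0 ⟨l, by omega⟩)
    · exact (odd_eq ⟨l, by omega⟩ (by simp only; omega)).trans (h1 ⟨l, by omega⟩)

theorem exists_halfVec_eq {m : ℕ} (v w : Fin (2 ^ m) → ZMod 2) :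
    ∃ u : Fin (2 ^ (m + 1)) → ZMod 2, halfVec 0 u = v ∧ halfVec 1 u = w := by
  refine ⟨fun z => ![v, w] ((interleaveEquiv m).symm z).2 ((interleaveEquiv m).symm z).1, ?_, ?_⟩
    <;> funext x <;> simp [halfVec]

/-- The even-index polar coset recursion:
`C_{2n}^{(2i)}(u_{2i-1}, u_{2i})` is the union over `u_{2i+1} ∈ F₂` of the sets of
concatenations `(c₁, c₂)` with
`c₁ ∈ C_n^{(i)}(u_{2i-1,even} ⊕ u_{2i-1,odd}, u_{2i} ⊕ u_{2i+1})` and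
`c₂ ∈ C_n^{(i)}(u_{2i-1,odd}, u_{2i+1})`, and the two sets in this union
(for `u_{2i+1} = 0` and `u_{2i+1} = 1`) are disjoint. -/
theorem polarCoset_even_rec (m i : ℕ) (hi : i < 2 ^ m)
    (p : Fin (2 * i) → ZMod 2) (b : ZMod 2) :
    (polarCoset (m + 1) (2 * i) p b =
      ⋃ b' : ZMod 2,
        { c | ∃ c1 ∈ polarCoset m i (evPart p + odPart p) (b + b'),
              ∃ c2 ∈ polarCoset m i (odPart p) b', c = concatPow c1 c2 }) ∧
    Disjoint
      ({ c | ∃ c1 ∈ polarCoset m i (evPart p + odPart p) (b + 0),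
             ∃ c2 ∈ polarCoset m i (odPart p) 0, c = concatPow c1 c2 } :
        Set (Fin (2 ^ (m + 1)) → ZMod 2))
      { c | ∃ c1 ∈ polarCoset m i (evPart p + odPart p) (b + 1),
            ∃ c2 ∈ polarCoset m i (odPart p) 1, c = concatPow c1 c2 } := by
  have hi2 : 2 * i < 2 ^ (m + 1) := by rw [pow_succ]; omega
  have mid (u : Fin (2 ^ (m + 1)) → ZMod 2) : u ⟨2 * i, hi2⟩ = halfVec 0 u ⟨i, hi⟩ :=
    congrArg u (Fin.ext (by simp))
  refine ⟨?_, ?_⟩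
  · ext c
    simp only [Set.mem_iUnion, Set.mem_ofPred_eq, mem_polarCoset_iff hi, mem_polarCoset_iff hi2,
      forall_init_eq_iff hi2 hi, mid]
    constructor
    · rintro ⟨u, ⟨h0, h1⟩, hb, rfl⟩
      exact ⟨halfVec 1 u ⟨i, hi⟩, _,
        ⟨halfVec 0 u + halfVec 1 u, fun k => by simp [h0, h1], by simp [hb], rfl⟩, _,
        ⟨halfVec 1 u, h1, rfl, rfl⟩, vecMul_Gmat_succ u⟩
    · rintro ⟨b', _, ⟨v, hv, hvb, rfl⟩, _, ⟨w, hw, hwb, rfl⟩, rfl⟩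
      obtain ⟨u, h0, h1⟩ := exists_halfVec_eq (v - w) w
      refine ⟨u, ⟨fun k => ?_, fun k => ?_⟩, ?_, ?_⟩
      · simp [h0, hv, hw]
      · rw [h1, hw]
      · simp [h0, hvb, hwb]
      · rw [vecMul_Gmat_succ, h0, h1, sub_add_cancel]
  · rw [Set.disjoint_left]
    rintro _ ⟨c1, _, c2, h2, rfl⟩ ⟨d1, _, d2, h2', h⟩
    obtain ⟨u, _, hu, rfl⟩ := (mem_polarCoset_iff hi).mp h2
    obtain ⟨v, _, hv, rfl⟩ := (mem_polarCoset_iff hi).mp h2'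
    have huv : u = v := vecMul_Gmat_injective m (concatPow_inj.mp h).2
    rw [huv, hv] at hu
    exact one_ne_zero hu
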